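/- Let V be a 6-dimensional F-vector space (char F ≠ 2,3) with non-degenerate Ω ∈ Λ²V*. For θ ∈ Λ³V* define Ω^θ ∈ Λ⁶V* by Ω^θ = (1/36)·alt[Ω̃ ∘ ((J^θ⊼J^θ) ⊗ (J^θ⊼J^θ))], where J^θ⊼J^θ: Λ³V → V is the cyclic-sum tensor and Ω̃(x⊗y) = Ω(x,y). Since dim Λ⁶V* = 1 and Ω∧Ω∧Ω ≠ 0, there exists a unique scalar I₂(θ) ∈ F with Ω^θ = I₂(θ)·Ω∧Ω∧Ω. Then I₂ is Sp(Ω)-invariant: I₂(A·θ) = I₂(θ) for all A ∈ Sp(Ω). -/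

import Mathlib

open scoped TensorProduct

/-- The wedge product of two alternating forms. -/
noncomputable def wedgeForm {F V : Type*} [CommRing F] [AddCommGroup V] [Module F V]
    {m n : ℕ} (ω : V [⋀^Fin m]→ₗ[F] F) (η : V [⋀^Fin n]→ₗ[F] F) :
    V [⋀^Fin (m + n)]→ₗ[F] F :=
  ((TensorProduct.lid F F).toLinearMap.compAlternatingMap
    (ω.domCoprod η)).domDomCongr finSumFinEquiv

theorem wedgeForm_factorial_smul {F V : Type*} [CommRing F] [AddCommGroup V] [Module F V]
    {m n : ℕ} (ω : V [⋀^Fin m]→ₗ[F] F) (η : V [⋀^Fin n]→ₗ[F] F) (x : Fin (m + n) → V) :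
    ((m.factorial * n.factorial : ℕ) : F) * wedgeForm ω η x =
      ∑ σ : Equiv.Perm (Fin (m + n)), ((Equiv.Perm.sign σ : ℤ) : F) *
        (ω (fun i => x (σ (Fin.castAdd n i))) * η (fun j => x (σ (Fin.natAdd m j)))) := by
  have h := congrArg (fun f => TensorProduct.lid F F (f (x ∘ finSumFinEquiv)))
    (MultilinearMap.domCoprod_alternization_eq ω η)
  simp only [AlternatingMap.smul_apply, MultilinearMap.alternatization_apply, Fintype.card_fin,
    map_sum, map_nsmul] at h
  have hw : wedgeForm ω η x = TensorProduct.lid F F (ω.domCoprod η (x ∘ finSumFinEquiv)) := rfl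
  rw [hw, ← nsmul_eq_mul, ← h]
  refine Fintype.sum_equiv (finSumFinEquiv.permCongr) _ _ fun σ => ?_
  rw [Units.smul_def, map_zsmul, zsmul_eq_mul]
  simp

theorem update_vecCons_one {V : Type*} (x y z : V) :
    Function.update ![x, y] 1 z = ![x, z] := by
  ext i; fin_cases i <;> rfl

/-- An alternating `2`-form as a bilinear form. -/
def AlternatingMap.toBilin {F V : Type*} [CommRing F] [AddCommGroup V] [Module F V]
    (Ω : V [⋀^Fin 2]→ₗ[F] F) : V →ₗ[F] V →ₗ[F] F :=
  LinearMap.mk₂ F (fun x y => Ω ![x, y])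
    (fun a b y => by simpa using Ω.map_vecCons_add ![y] a b)
    (fun c a y => by simpa using Ω.map_vecCons_smul ![y] c a)
    (fun x a b => by
      simpa only [update_vecCons_one] using Ω.map_update_add ![x, 0] 1 a b)
    (fun c x a => by
      simpa only [update_vecCons_one] using Ω.map_update_smul ![x, 0] 1 c a)

@[simp]
theorem AlternatingMap.toBilin_apply {F V : Type*} [CommRing F] [AddCommGroup V] [Module F V]
    (Ω : V [⋀^Fin 2]→ₗ[F] F) (x y : V) : Ω.toBilin x y = Ω ![x, y] := rfl

theorem AlternatingMap.toBilin_isAlt {F V : Type*} [CommRing F] [AddCommGroup V] [Module F V]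
    (Ω : V [⋀^Fin 2]→ₗ[F] F) : Ω.toBilin.IsAlt := fun x =>
  Ω.map_eq_zero_of_eq ![x, x] (i := 0) (j := 1) rfl (by decide)

theorem sum_perm_fin_succ {M : Type*} [AddCommMonoid M] {n : ℕ}
    (f : Equiv.Perm (Fin (n + 1)) → M) :
    ∑ σ, f σ = ∑ i : Fin (n + 1), ∑ τ : Equiv.Perm (Fin n),
      f (Equiv.Perm.decomposeFin.symm (i, τ)) := by
  rw [← Fintype.sum_prod_type', ← Equiv.sum_comp Equiv.Perm.decomposeFin.symm]

theorem sum_perm_fin_four {R : Type*} [Ring R] (f : Fin 4 → Fin 4 → Fin 4 → Fin 4 → R) :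
    ∑ σ : Equiv.Perm (Fin 4), ((Equiv.Perm.sign σ : ℤ) : R) * f (σ 0) (σ 1) (σ 2) (σ 3) =
      f 0 1 2 3 - f 0 1 3 2 - f 0 2 1 3 + f 0 2 3 1 + f 0 3 1 2 - f 0 3 2 1
      - f 1 0 2 3 + f 1 0 3 2 + f 1 2 0 3 - f 1 2 3 0 - f 1 3 0 2 + f 1 3 2 0
      + f 2 0 1 3 - f 2 0 3 1 - f 2 1 0 3 + f 2 1 3 0 + f 2 3 0 1 - f 2 3 1 0
      - f 3 0 1 2 + f 3 0 2 1 + f 3 1 0 2 - f 3 1 2 0 - f 3 2 0 1 + f 3 2 1 0 := by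
  have h2 : (2 : Fin 4) = Fin.succ 1 := rfl
  have h3 : (3 : Fin 4) = Fin.succ 2 := rfl
  have h2' : (2 : Fin 3) = Fin.succ 1 := rfl
  have e4 (f : Equiv.Perm (Fin 4) → R) : ∑ σ, f σ = ∑ i : Fin 4, ∑ τ : Equiv.Perm (Fin 3),
    f (Equiv.Perm.decomposeFin.symm (i, τ)) := sum_perm_fin_succ f
  have e3 (f : Equiv.Perm (Fin 3) → R) : ∑ σ, f σ = ∑ i : Fin 3, ∑ τ : Equiv.Perm (Fin 2),
    f (Equiv.Perm.decomposeFin.symm (i, τ)) := sum_perm_fin_succ f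
  have e2 (f : Equiv.Perm (Fin 2) → R) : ∑ σ, f σ = ∑ i : Fin 2, ∑ τ : Equiv.Perm (Fin 1),
    f (Equiv.Perm.decomposeFin.symm (i, τ)) := sum_perm_fin_succ f
  simp only [e4, e3, e2, Fin.sum_univ_four, Fin.sum_univ_three, Fin.sum_univ_two,
    Fintype.sum_unique]
  simp only [h2, h3, Equiv.Perm.decomposeFin_symm_apply_zero,
    Equiv.Perm.decomposeFin_symm_apply_succ, Equiv.Perm.decomposeFin_symm_apply_one, h2',
    Equiv.Perm.decomposeFin.symm_sign]
  simp [Equiv.swap_apply_def, Fin.ext_iff]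
  abel

theorem wedgeForm_two_two {F V : Type*} [Field F] [AddCommGroup V] [Module F V]
    (h2 : (2 : F) ≠ 0) (Ω : V [⋀^Fin 2]→ₗ[F] F) (y : Fin 4 → V) :
    wedgeForm Ω Ω y = 2 * (Ω ![y 0, y 1] * Ω ![y 2, y 3] - Ω ![y 0, y 2] * Ω ![y 1, y 3]
      + Ω ![y 0, y 3] * Ω ![y 1, y 2]) := by
  have h := wedgeForm_factorial_smul Ω Ω y
  have hpair : ∀ f : Fin 2 → V, Ω f = Ω ![f 0, f 1] := fun f => by
    congr 1; ext i; fin_cases i <;> rfl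
  have hsum : ∑ σ : Equiv.Perm (Fin 4), ((Equiv.Perm.sign σ : ℤ) : F) *
      (Ω ![y (σ 0), y (σ 1)] * Ω ![y (σ 2), y (σ 3)]) =
      8 * (Ω ![y 0, y 1] * Ω ![y 2, y 3] - Ω ![y 0, y 2] * Ω ![y 1, y 3]
        + Ω ![y 0, y 3] * Ω ![y 1, y 2]) := by
    have hswap : ∀ a b, Ω ![a, b] = -Ω ![b, a] := fun a b =>
      (Ω.toBilin_isAlt.neg b a).symm
    rw [sum_perm_fin_four fun a b c d => Ω ![y a, y b] * Ω ![y c, y d]]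
    simp only [hswap (y 1) (y 0), hswap (y 2) (y 0), hswap (y 3) (y 0), hswap (y 2) (y 1),
      hswap (y 3) (y 1), hswap (y 3) (y 2)]
    ring
  have e : ((Nat.factorial 2 * Nat.factorial 2 : ℕ) : F) = 2 * 2 := by
    norm_num [Nat.factorial]
  rw [e] at h
  apply mul_left_cancel₀ (mul_ne_zero h2 h2)
  refine h.trans (Eq.trans (Finset.sum_congr rfl fun σ _ => ?_) (hsum.trans (by ring)))
  rw [hpair fun i => y (σ (Fin.castAdd 2 i)), hpair fun j => y (σ (Fin.natAdd 2 j))]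
  rfl

/-- The Gram matrix of a symplectic basis `e₁, f₁, e₂, f₂, e₃, f₃`. -/
def symplecticGram (i j : Fin 6) : ℤ :=
  if i.val / 2 = j.val / 2 then (j.val : ℤ) - i.val else 0

theorem sum_sign_mul_symplecticGram :
    ∑ σ : Equiv.Perm (Fin 6), (Equiv.Perm.sign σ : ℤ) *
      ((symplecticGram (σ 0) (σ 1) * symplecticGram (σ 2) (σ 3)
        - symplecticGram (σ 0) (σ 2) * symplecticGram (σ 1) (σ 3)
        + symplecticGram (σ 0) (σ 3) * symplecticGram (σ 1) (σ 2))
        * symplecticGram (σ 4) (σ 5)) = 144 := by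
  decide +kernel

theorem wedgeForm_cube_of_symplecticGram {F V : Type*} [Field F] [AddCommGroup V] [Module F V]
    (h2 : (2 : F) ≠ 0) (h3 : (3 : F) ≠ 0) (Ω : V [⋀^Fin 2]→ₗ[F] F) (x : Fin 6 → V)
    (hx : ∀ i j, Ω ![x i, x j] = symplecticGram i j) :
    (wedgeForm (wedgeForm Ω Ω) Ω : V [⋀^Fin 6]→ₗ[F] F) x = 6 := by
  have h := wedgeForm_factorial_smul (wedgeForm Ω Ω) Ω x
  have hpair : ∀ f : Fin 2 → V, Ω f = Ω ![f 0, f 1] := fun f => by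
    congr 1; ext i; fin_cases i <;> rfl
  simp only [wedgeForm_two_two h2] at h
  have h6 : ∀ σ : Equiv.Perm (Fin 6),
      Ω (fun j : Fin 2 => x (σ (Fin.natAdd (2 + 2) j))) = symplecticGram (σ 4) (σ 5) :=
    fun σ => (hpair _).trans (hx _ _)
  have key := congrArg (Int.cast (R := F)) sum_sign_mul_symplecticGram
  have h48 : (48 : F) ≠ 0 := by
    have : (48 : F) = 2 ^ 4 * 3 := by norm_num
    rw [this]; exact mul_ne_zero (pow_ne_zero _ h2) h3
  apply mul_left_cancel₀ h48
  have e : ((Nat.factorial (2 + 2) * Nat.factorial 2 : ℕ) : F) = 48 := by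
    norm_num [Nat.factorial]
  rw [e] at h
  refine h.trans ?_
  have e2 : (48 * 6 : F) = 2 * ((144 : ℤ) : F) := by norm_num
  rw [e2, ← key, Int.cast_sum, Finset.mul_sum]
  refine Finset.sum_congr rfl fun σ _ => ?_
  rw [h6 σ]
  simp only [hx]
  push_cast
  ring

/-- A partial symplectic basis of fewer than `dim V` vectors extends by one hyperbolic pair. -/
theorem exists_hyperbolic_pair {F V : Type*} [Field F] [AddCommGroup V] [Module F V]
    [FiniteDimensional F V] (B : V →ₗ[F] V →ₗ[F] F) (hB : B.IsAlt)
    (hnd : ∀ x : V, (∀ y : V, B x y = 0) → x = 0) {k : ℕ} (e f : Fin k → V)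
    (hk : 2 * k < Module.finrank F V)
    (hee : ∀ i j, B (e i) (e j) = 0) (hff : ∀ i j, B (f i) (f j) = 0)
    (hef : ∀ i j, B (e i) (f j) = if i = j then 1 else 0) :
    ∃ a b : V, B a b = 1 ∧ (∀ i, B (e i) a = 0) ∧ (∀ i, B (f i) a = 0) ∧
      (∀ i, B (e i) b = 0) ∧ (∀ i, B (f i) b = 0) := by
  have hfe : ∀ i j, B (f i) (e j) = if i = j then -1 else 0 := fun i j => by
    rw [← hB.neg, hef]; split_ifs <;> simp_all
  let L : V →ₗ[F] (Fin k ⊕ Fin k → F) := LinearMap.pi (Sum.elim (fun i => B (e i)) fun i => B (f i))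
  have hker : LinearMap.ker L ≠ ⊥ := L.ker_ne_bot_of_finrank_lt (by
    simpa [two_mul] using hk)
  obtain ⟨a, ha, ha0⟩ := (Submodule.ne_bot_iff _).mp hker
  have hea : ∀ i, B (e i) a = 0 := fun i => congrFun (LinearMap.mem_ker.mp ha) (Sum.inl i)
  have hfa : ∀ i, B (f i) a = 0 := fun i => congrFun (LinearMap.mem_ker.mp ha) (Sum.inr i)
  have hae : ∀ i, B a (e i) = 0 := fun i => by rw [← hB.neg, hea, neg_zero]
  have haf : ∀ i, B a (f i) = 0 := fun i => by rw [← hB.neg, hfa, neg_zero]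
  obtain ⟨y, hy⟩ : ∃ y, B a y ≠ 0 := by
    by_contra! h
    exact ha0 (hnd a h)
  let z := (B a y)⁻¹ • y
  refine ⟨a, z - ∑ i, B (e i) z • f i + ∑ i, B (f i) z • e i, ?_, hea, hfa, ?_, ?_⟩
  · simp [z, hae, haf, hy]
  · intro i
    simp [hee, hef, map_sum]
  · intro i
    simp [hff, hfe, map_sum]

theorem exists_symplecticGram {F V : Type*} [Field F] [AddCommGroup V] [Module F V]
    [FiniteDimensional F V] (hdim : Module.finrank F V = 6) (Ω : V [⋀^Fin 2]→ₗ[F] F)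
    (hΩ : ∀ x : V, (∀ y : V, Ω ![x, y] = 0) → x = 0) :
    ∃ x : Fin 6 → V, ∀ i j, Ω ![x i, x j] = symplecticGram i j := by
  have hB := Ω.toBilin_isAlt
  set B := Ω.toBilin with hBdef
  have hnd : ∀ x : V, (∀ y : V, B x y = 0) → x = 0 := hΩ
  obtain ⟨e₁, f₁, h₁, -⟩ := exists_hyperbolic_pair B hB hnd (k := 0) ![] ![] (by omega)
    (by simp) (by simp) (by simp)
  have hfe₁ : B f₁ e₁ = -1 := by rw [← hB.neg, h₁]
  obtain ⟨e₂, f₂, h₂, he₁e₂, hf₁e₂, he₁f₂, hf₁f₂⟩ :=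
    exists_hyperbolic_pair B hB hnd (k := 1) ![e₁] ![f₁] (by omega)
      (by simp [hB e₁]) (by simp [hB f₁]) (by simp [h₁, Fin.forall_fin_one])
  simp only [Fin.forall_fin_one, Matrix.cons_val_zero] at he₁e₂ hf₁e₂ he₁f₂ hf₁f₂
  have flip : ∀ {u v}, B u v = 0 → B v u = 0 := fun h => by rw [← hB.neg, h, neg_zero]
  have hfe₂ : B f₂ e₂ = -1 := by rw [← hB.neg, h₂]
  obtain ⟨e₃, f₃, h₃, hee₃, hfe₃, hef₃, hff₃⟩ :=
    exists_hyperbolic_pair B hB hnd (k := 2) ![e₁, e₂] ![f₁, f₂] (by omega)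
      (by simp [Fin.forall_fin_two, hB e₁, hB e₂, he₁e₂, flip he₁e₂])
      (by simp [Fin.forall_fin_two, hB f₁, hB f₂, hf₁f₂, flip hf₁f₂])
      (by simp [Fin.forall_fin_two, h₁, h₂, he₁f₂, flip hf₁e₂])
  simp only [Fin.forall_fin_two, Matrix.cons_val_zero, Matrix.cons_val_one] at hee₃ hfe₃ hef₃ hff₃
  have hfe₃' : B f₃ e₃ = -1 := by rw [← hB.neg, h₃]
  refine ⟨![e₁, f₁, e₂, f₂, e₃, f₃], fun i j => ?_⟩
  rw [← AlternatingMap.toBilin_apply, ← hBdef]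
  fin_cases i <;> fin_cases j <;>
    simp [symplecticGram, hB _, h₁, h₂, h₃, hfe₁, hfe₂, hfe₃', he₁e₂, hf₁e₂, he₁f₂, hf₁f₂,
      flip he₁e₂, flip hf₁e₂, flip he₁f₂, flip hf₁f₂, hee₃, hfe₃, hef₃, hff₃,
      flip hee₃.1, flip hee₃.2, flip hfe₃.1, flip hfe₃.2, flip hef₃.1, flip hef₃.2,
      flip hff₃.1, flip hff₃.2]

/-- The alternation of `Ω(T(x₀, x₁, x₂), T(x₃, x₄, x₅))` over its six arguments. -/
noncomputable def alternatedPairing {F V : Type*} [CommRing F] [AddCommGroup V] [Module F V]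
    (Ω : V [⋀^Fin 2]→ₗ[F] F) (T : V [⋀^Fin 3]→ₗ[F] V) : V [⋀^Fin 6]→ₗ[F] F :=
  MultilinearMap.alternatization (((TensorProduct.lift Ω.toBilin).compMultilinearMap
    (MultilinearMap.domCoprod (T : MultilinearMap F (fun _ : Fin 3 => V) V)
      (T : MultilinearMap F (fun _ : Fin 3 => V) V))).domDomCongr finSumFinEquiv)

theorem alternatedPairing_apply {F V : Type*} [CommRing F] [AddCommGroup V] [Module F V]
    (Ω : V [⋀^Fin 2]→ₗ[F] F) (T : V [⋀^Fin 3]→ₗ[F] V) (x : Fin 6 → V) :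
    alternatedPairing Ω T x = ∑ σ : Equiv.Perm (Fin 6), ((Equiv.Perm.sign σ : ℤ) : F)
      * Ω ![T ![x (σ 0), x (σ 1), x (σ 2)], T ![x (σ 3), x (σ 4), x (σ 5)]] := by
  rw [alternatedPairing, MultilinearMap.alternatization_apply]
  refine Finset.sum_congr rfl fun σ _ => ?_
  have h0 : (fun i : Fin 3 => x (σ (finSumFinEquiv (Sum.inl i : Fin 3 ⊕ Fin 3))))
      = ![x (σ 0), x (σ 1), x (σ 2)] := by
    ext i; fin_cases i <;> rfl
  have h1 : (fun i : Fin 3 => x (σ (finSumFinEquiv (Sum.inr i : Fin 3 ⊕ Fin 3))))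
      = ![x (σ 3), x (σ 4), x (σ 5)] := by
    ext i; fin_cases i <;> rfl
  rw [← h0, ← h1]
  simp [Units.smul_def]

theorem AlternatingMap.eq_div_mul {F V ι : Type*} [Field F] [AddCommGroup V] [Module F V]
    [FiniteDimensional F V] [Fintype ι] (hι : Module.finrank F V = Fintype.card ι)
    (f w : V [⋀^ι]→ₗ[F] F) {s : ι → V} (hs : w s ≠ 0) (x : ι → V) :
    f x = f s / w s * w x := by
  classical
  let b : Module.Basis ι F V := Module.finBasisOfFinrankEq F V hι |>.reindex
    (Fintype.equivFin ι).symm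
  have hf := f.eq_smul_basis_det b
  have hw := w.eq_smul_basis_det b
  have hf' : ∀ y, f y = f b * b.det y := fun y => congrArg (· y) hf
  have hw' : ∀ y, w y = w b * b.det y := fun y => congrArg (· y) hw
  rw [div_mul_eq_mul_div, eq_div_iff hs, hf' x, hf' s, hw' x, hw' s]
  ring

/-- there is a unique scalar `I₂(θ)` with
`Ω^θ = I₂(θ)·Ω∧Ω∧Ω`, where
`Ω^θ = (1/36)·alt[Ω̃∘((J^θ⊼J^θ)⊗(J^θ⊼J^θ))]`, and `I₂` is
`Sp(Ω)`-invariant. -/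
theorem stmt_14 (F V : Type*) [Field F] [AddCommGroup V] [Module F V]
    [FiniteDimensional F V] (hdim : Module.finrank F V = 6)
    (hchar2 : (2 : F) ≠ 0) (hchar3 : (3 : F) ≠ 0)
    (Ω : V [⋀^Fin 2]→ₗ[F] F)
    (hΩ : ∀ x : V, (∀ y : V, Ω ![x, y] = 0) → x = 0)
    (A : V ≃ₗ[F] V) (hA : ∀ x y : V, Ω ![A x, A y] = Ω ![x, y])
    (θ θ' : V [⋀^Fin 3]→ₗ[F] F)
    (hθ' : ∀ x y z : V, θ' ![x, y, z] = θ ![A.symm x, A.symm y, A.symm z])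
    (J J' : V [⋀^Fin 2]→ₗ[F] V)
    (hJ : ∀ x y z : V, θ ![x, y, z] = Ω ![J ![x, y], z])
    (hJ' : ∀ x y z : V, θ' ![x, y, z] = Ω ![J' ![x, y], z])
    (T T' : V [⋀^Fin 3]→ₗ[F] V)
    (hT : ∀ x₁ x₂ x₃ : V, T ![x₁, x₂, x₃]
        = J ![J ![x₁, x₂], x₃] + J ![J ![x₂, x₃], x₁] + J ![J ![x₃, x₁], x₂])
    (hT' : ∀ x₁ x₂ x₃ : V, T' ![x₁, x₂, x₃]
        = J' ![J' ![x₁, x₂], x₃] + J' ![J' ![x₂, x₃], x₁] + J' ![J' ![x₃, x₁], x₂]) :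
    (∃! c : F, ∀ x : Fin 6 → V,
      (1 / 36 : F) * ∑ σ : Equiv.Perm (Fin 6),
          ((Equiv.Perm.sign σ : ℤ) : F)
            * Ω ![T ![x (σ 0), x (σ 1), x (σ 2)], T ![x (σ 3), x (σ 4), x (σ 5)]]
        = c * (wedgeForm (wedgeForm Ω Ω) Ω : V [⋀^Fin 6]→ₗ[F] F) x) ∧
    ∀ c c' : F,
      (∀ x : Fin 6 → V,
        (1 / 36 : F) * ∑ σ : Equiv.Perm (Fin 6),
            ((Equiv.Perm.sign σ : ℤ) : F)
              * Ω ![T ![x (σ 0), x (σ 1), x (σ 2)], T ![x (σ 3), x (σ 4), x (σ 5)]]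
          = c * (wedgeForm (wedgeForm Ω Ω) Ω : V [⋀^Fin 6]→ₗ[F] F) x) →
      (∀ x : Fin 6 → V,
        (1 / 36 : F) * ∑ σ : Equiv.Perm (Fin 6),
            ((Equiv.Perm.sign σ : ℤ) : F)
              * Ω ![T' ![x (σ 0), x (σ 1), x (σ 2)], T' ![x (σ 3), x (σ 4), x (σ 5)]]
          = c' * (wedgeForm (wedgeForm Ω Ω) Ω : V [⋀^Fin 6]→ₗ[F] F) x) →
      c' = c := by
  obtain ⟨s, hs⟩ := exists_symplecticGram hdim Ω hΩ
  have h6 : (6 : F) ≠ 0 := by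
    have : (6 : F) = 2 * 3 := by norm_num
    rw [this]; exact mul_ne_zero hchar2 hchar3
  have hw := wedgeForm_cube_of_symplecticGram hchar2 hchar3 Ω s hs
  have hAw := wedgeForm_cube_of_symplecticGram hchar2 hchar3 Ω (fun i => A (s i))
    fun i j => (hA _ _).trans (hs i j)
  set w : V [⋀^Fin 6]→ₗ[F] F := wedgeForm (wedgeForm Ω Ω) Ω
  have hws : w s ≠ 0 := hw ▸ h6
  constructor
  · simp only [← alternatedPairing_apply]
    refine ⟨1 / 36 * (alternatedPairing Ω T s / w s), fun x => ?_, fun c hc => ?_⟩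
    · rw [(alternatedPairing Ω T).eq_div_mul (by simpa using hdim) w hws x]
      ring
    · have := hc s
      rw [← mul_div_assoc, this, mul_div_cancel_right₀ _ hws]
  · intro c c' hc hc'
    have hJJ : ∀ x y, J' ![A x, A y] = A (J ![x, y]) := fun x y => by
      rw [← sub_eq_zero]
      refine hΩ _ fun z => ?_
      have h := hJ' (A x) (A y) z
      rw [hθ', A.symm_apply_apply, A.symm_apply_apply, hJ, ← hA, A.apply_symm_apply] at h
      simp only [← AlternatingMap.toBilin_apply] at h ⊢
      rw [map_sub, LinearMap.sub_apply, h, sub_self]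
    have hTT : ∀ x y z, T' ![A x, A y, A z] = A (T ![x, y, z]) := fun x y z => by
      simp only [hT, hT', hJJ, map_add]
    have h := hc s
    have h' := hc' fun i => A (s i)
    simp only [hTT, hA] at h'
    rw [h, hw, hAw] at h'
    exact (mul_right_cancel₀ h6 h').symm
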